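/- Let Γ be a graph with two non-adjacent vertices u and v where u is unlooped, let k ∈ ℕ, w_i = u v^i for i ∈ [1,k], W = {w₁,…,w_k} and R = {(w_i w̄_i, ε) : i ∈ [1,k]}. Then for every x ∈ (W ∪ W̄)* with x ≡_Γ ε, it holds that x ↔*_R ε and moreover every occurrence of a factor w_i w̄_j in x (i.e., every factorization x = s w_i w̄_j t with s, t ∈ (W ∪ W̄)*) satisfies i = j. -/

import Mathlib

open scoped Classical

/-- An undirected graph (finite in applications), with self-loops allowed:
`adj v v` means that `v` is looped. -/
structure GGraph (V : Type) where
  adj : V → V → Prop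
  symm : ∀ u v, adj u v → adj v u

namespace ValencePaper

variable {V Q : Type}

/-- The alphabet `X_Γ = V ∪ V̄`: `Sum.inl v` is the letter `v`,
`Sum.inr v` is the letter `v̄`. -/
abbrev XLetter (V : Type) := V ⊕ V

/-- Words over `X_Γ`. -/
abbrev GWord (V : Type) := List (XLetter V)

/-- The bar operation on letters, swapping `v` and `v̄`. -/
def barL : XLetter V → XLetter V := Sum.elim Sum.inr Sum.inl

/-- The inverse word `w̄`. -/
def barW (w : GWord V) : GWord V := (w.map barL).reverse

/-- The vertex a letter refers to. -/
def vtx : XLetter V → V := Sum.elim id id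

/-- One-step rewriting `s u t →_R s v t` for a set of rules `R`. -/
inductive RStep {α : Type} (R : Set (List α × List α)) : List α → List α → Prop
  | intro (s t : List α) {a b : List α} (h : (a, b) ∈ R) :
      RStep R (s ++ a ++ t) (s ++ b ++ t)

/-- The rule set `R_Γ`: cancellation `v v̄ → ε` and commutation `xy → yx`
for letters over adjacent vertices. -/
def GRules (Γ : GGraph V) : Set (GWord V × GWord V) :=
  {p | ∃ v : V, p = ([Sum.inl v, Sum.inr v], [])} ∪
  {p | ∃ (a b : V) (x y : XLetter V),
      (x = Sum.inl a ∨ x = Sum.inr a) ∧ (y = Sum.inl b ∨ y = Sum.inr b) ∧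
      Γ.adj a b ∧ p = ([x, y], [y, x])}

/-- The congruence `≡_Γ`: the smallest equivalence relation containing `→_Γ`. -/
def GEquiv (Γ : GGraph V) : GWord V → GWord V → Prop :=
  Relation.EqvGen (RStep (GRules Γ))

/-- The graph monoid `MΓ = X_Γ*/≡_Γ`. -/
def GMonoid (Γ : GGraph V) := Quot (RStep (GRules Γ))

/-- The class `[w]` of a word `w` in `MΓ`. -/
def gmk (Γ : GGraph V) (w : GWord V) : GMonoid Γ := Quot.mk _ w

/-- Runs of a valence system with transition set `E`: `Run E p w q` means
there is a sequence of transitions from `p` to `q` whose labels concatenate to `w`. -/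
inductive Run (E : Set (Q × GWord V × Q)) : Q → GWord V → Q → Prop
  | nil (q : Q) : Run E q [] q
  | cons {p : Q} {w : GWord V} {q : Q} {u : GWord V} {r : Q} :
      (p, w, q) ∈ E → Run E q u r → Run E p (w ++ u) r

/-- A transition set is bidirected if for any transition `p →w q`
it also contains the transition `q →w̄ p`. -/
def Bidirected (E : Set (Q × GWord V × Q)) : Prop :=
  ∀ p w q, (p, w, q) ∈ E → (q, barW w, p) ∈ E

/-- Every vertex of `Γ` carries a self-loop. -/
def Looped (Γ : GGraph V) : Prop := ∀ v, Γ.adj v v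

/-- `Γ°`: the graph `Γ` with self-loops added on all vertices. -/
def loopify (Γ : GGraph V) : GGraph V :=
  ⟨fun a b => Γ.adj a b ∨ a = b, by
    intro u v h
    rcases h with h | h
    · exact Or.inl (Γ.symm u v h)
    · exact Or.inr h.symm⟩

end ValencePaper

namespace ValencePaper

variable {V : Type}

/-- The word `w_i = u v^i`. -/
def pword (u v : V) (i : ℕ) : GWord V :=
  Sum.inl u :: List.replicate i (Sum.inl v)

/-- The rule set `R = {(w_i w̄_i, ε) : i ∈ [1,k]}`. -/
def cancelRules (u v : V) (k : ℕ) : Set (GWord V × GWord V) :=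
  {p | ∃ i : ℕ, 1 ≤ i ∧ i ≤ k ∧ p = (pword u v i ++ barW (pword u v i), ([] : GWord V))}

/-- Membership in `(W ∪ W̄)*` for `W = {w₁, …, w_k}`: `x` is a concatenation of
blocks, each of which is some `w_i` or `w̄_i` with `i ∈ [1,k]`. -/
def InStar (u v : V) (k : ℕ) (x : GWord V) : Prop :=
  ∃ parts : List (GWord V),
    (∀ b ∈ parts, ∃ i : ℕ, 1 ≤ i ∧ i ≤ k ∧ (b = pword u v i ∨ b = barW (pword u v i))) ∧
    x = parts.flatten

end ValencePaper

namespace ValencePaper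

variable {V : Type}

/-- The partial action of a letter on a stack of integer counters: `u` pushes a zero, `ū` pops a
zero, `v` and `v̄` increment and decrement the top counter, and all other letters do nothing. -/
noncomputable def stackStep (u v : V) : List ℤ → XLetter V → Option (List ℤ)
  | s, Sum.inl a =>
      if a = u then some (0 :: s) else if a = v then some (s.modifyHead (· + 1)) else some s
  | s, Sum.inr a =>
      if a = u then (if s.head? = some 0 then some s.tail else none)
      else if a = v then some (s.modifyHead (· - 1)) else some s

/-- The partial action of a word on a stack of integer counters, read from left to right. -/
noncomputable def stackRun (u v : V) (w : GWord V) (s : List ℤ) : Option (List ℤ) :=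
  w.foldlM (stackStep u v) s

theorem stackRun_nil (u v : V) (s : List ℤ) : stackRun u v [] s = some s := rfl

theorem stackRun_cons (u v : V) (a : XLetter V) (w : GWord V) (s : List ℤ) :
    stackRun u v (a :: w) s = (stackStep u v s a).bind (stackRun u v w) := rfl

theorem stackRun_append (u v : V) (w w' : GWord V) (s : List ℤ) :
    stackRun u v (w ++ w') s = (stackRun u v w s).bind (stackRun u v w') :=
  List.foldlM_append

theorem stackRun_singleton (u v : V) (a : XLetter V) (s : List ℤ) :
    stackRun u v [a] s = stackStep u v s a := by
  simp [stackRun_cons, funext (stackRun_nil u v)]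

theorem stackRun_pair (u v : V) (a b : XLetter V) (s : List ℤ) :
    stackRun u v [a, b] s = (stackStep u v s a).bind (stackStep u v · b) := by
  rw [stackRun_cons, funext (stackRun_singleton u v b)]

theorem stackStep_of_ne {u v : V} {a : XLetter V} (hu : vtx a ≠ u) (hv : vtx a ≠ v)
    (s : List ℤ) : stackStep u v s a = some s := by
  cases a <;> simp_all [stackStep, vtx]

theorem stackStep_comm_of_vtx {u v : V} (huv : u ≠ v) {a b : XLetter V} (ha : vtx a = v)
    (hb : vtx b = v) (s : List ℤ) :
    (stackStep u v s a).bind (stackStep u v · b) =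
      (stackStep u v s b).bind (stackStep u v · a) := by
  cases a <;> cases b <;> cases s <;> simp_all [stackStep, vtx, huv.symm]

theorem stackStep_comm_of_adj {Γ : GGraph V} {u v : V} (huv : u ≠ v) (hnadj : ¬ Γ.adj u v)
    (hunl : ¬ Γ.adj u u) {a b : XLetter V} (h : Γ.adj (vtx a) (vtx b)) (s : List ℤ) :
    (stackStep u v s a).bind (stackStep u v · b) =
      (stackStep u v s b).bind (stackStep u v · a) := by
  by_cases ha : vtx a ≠ u ∧ vtx a ≠ v
  · simp [stackStep_of_ne ha.1 ha.2]
  by_cases hb : vtx b ≠ u ∧ vtx b ≠ v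
  · simp [stackStep_of_ne hb.1 hb.2]
  have hnadj' : ¬ Γ.adj v u := fun h => hnadj (Γ.symm _ _ h)
  exact stackStep_comm_of_vtx huv (by grind) (by grind) s

theorem stackRun_eq_of_mem_GRules {Γ : GGraph V} {u v : V} (huv : u ≠ v)
    (hnadj : ¬ Γ.adj u v) (hunl : ¬ Γ.adj u u) {a b : GWord V} (h : (a, b) ∈ GRules Γ)
    (s : List ℤ) : stackRun u v a s = stackRun u v b s := by
  rcases h with ⟨c, hc⟩ | ⟨c, d, x, y, hx, hy, hcd, hp⟩
  · obtain ⟨rfl, rfl⟩ := Prod.mk.inj hc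
    rw [stackRun_pair, stackRun_nil]
    by_cases hcu : c = u
    · simp [stackStep, hcu]
    · by_cases hcv : c = v <;> cases s <;> simp [stackStep, hcu, hcv, huv.symm]
  · obtain ⟨rfl, rfl⟩ := Prod.mk.inj hp
    rw [stackRun_pair, stackRun_pair]
    refine stackStep_comm_of_adj huv hnadj hunl ?_ s
    rcases hx with rfl | rfl <;> rcases hy with rfl | rfl <;> exact hcd

theorem stackRun_eq_of_GEquiv {Γ : GGraph V} {u v : V} (huv : u ≠ v)
    (hnadj : ¬ Γ.adj u v) (hunl : ¬ Γ.adj u u) {x y : GWord V} (h : GEquiv Γ x y) (s : List ℤ) :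
    stackRun u v x s = stackRun u v y s := by
  induction h with
  | rel _ _ h =>
    obtain ⟨p, q, h⟩ := h
    simp only [stackRun_append, funext (stackRun_eq_of_mem_GRules huv hnadj hunl h)]
  | refl => rfl
  | symm _ _ _ ih => exact ih.symm
  | trans _ _ _ _ _ ih₁ ih₂ => exact ih₁.trans ih₂

theorem stackRun_replicate_inl {u v : V} (huv : u ≠ v) (i : ℕ) (n : ℤ) (s : List ℤ) :
    stackRun u v (List.replicate i (Sum.inl v)) (n :: s) = some ((n + i) :: s) := by
  induction i generalizing n with
  | zero => simp [stackRun_nil]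
  | succ i ih =>
    simp only [List.replicate_succ, stackRun_cons, stackStep, huv.symm, if_false, if_true,
      List.modifyHead_cons, Option.bind_some, ih]
    congr 2
    push_cast
    ring

theorem stackRun_replicate_inr {u v : V} (huv : u ≠ v) (i : ℕ) (s : List ℤ) :
    stackRun u v (List.replicate i (Sum.inr v)) s = some (s.modifyHead (· - (i : ℤ))) := by
  induction i generalizing s with
  | zero => cases s <;> simp [stackRun_nil]
  | succ i ih =>
    cases s with
    | nil => simp [List.replicate_succ, stackRun_cons, stackStep, huv.symm, ih]
    | cons n s =>
      simp only [List.replicate_succ, stackRun_cons, stackStep, huv.symm, if_false, if_true,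
        List.modifyHead_cons, Option.bind_some, ih]
      congr 2
      push_cast
      ring

theorem stackRun_pword {u v : V} (huv : u ≠ v) (i : ℕ) (s : List ℤ) :
    stackRun u v (pword u v i) s = some ((i : ℤ) :: s) := by
  simp [pword, stackRun_cons, stackStep, stackRun_replicate_inl huv]

theorem barW_pword (u v : V) (i : ℕ) :
    barW (pword u v i) = List.replicate i (Sum.inr v) ++ [Sum.inr u] := by
  simp [barW, pword, barL]

theorem stackRun_barW_pword_eq_some {u v : V} (huv : u ≠ v) {i : ℕ} {s s' : List ℤ} :
    stackRun u v (barW (pword u v i)) s = some s' ↔ s = (i : ℤ) :: s' := by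
  rw [barW_pword, stackRun_append, stackRun_replicate_inr huv]
  cases s <;> simp [stackRun_singleton, stackStep, sub_eq_zero]

theorem eqvGen_cancelRules_of_stackRun {u v : V} (huv : u ≠ v) {k : ℕ}
    {parts : List (GWord V)}
    (hparts : ∀ b ∈ parts,
      ∃ i : ℕ, 1 ≤ i ∧ i ≤ k ∧ (b = pword u v i ∨ b = barW (pword u v i)))
    {l : List ℕ} (h : stackRun u v parts.flatten (l.map (↑)) = some []) :
    Relation.EqvGen (RStep (cancelRules u v k))
      (l.reverse.flatMap (pword u v) ++ parts.flatten) [] := by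
  induction parts generalizing l with
  | nil =>
    obtain rfl : l = [] := by simpa [stackRun_nil] using h
    exact .refl _
  | cons b parts ih =>
    have ih := fun l => ih (l := l) fun b hb => hparts b (List.mem_cons_of_mem _ hb)
    obtain ⟨i, hi, hik, rfl | rfl⟩ := hparts b List.mem_cons_self
    · rw [List.flatten_cons, stackRun_append, stackRun_pword huv] at h
      simpa using ih (i :: l) h
    · rw [List.flatten_cons, stackRun_append, Option.bind_eq_some_iff] at h
      obtain ⟨s', hs', h⟩ := h
      rw [stackRun_barW_pword_eq_some huv] at hs'
      cases l with
      | nil => simp at hs'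
      | cons j l =>
        rw [List.map_cons, List.cons.injEq, Nat.cast_inj] at hs'
        obtain ⟨rfl, rfl⟩ := hs'
        refine .trans _ _ _ (.rel _ _ ?_) (ih l h)
        simpa using RStep.intro (R := cancelRules u v k) (l.reverse.flatMap (pword u v))
          parts.flatten ⟨j, hi, hik, rfl⟩

end ValencePaper

open ValencePaper

/-- Let `Γ` have two non-adjacent vertices `u, v` with `u` unlooped,
`k ∈ ℕ`, `w_i = u v^i`, `W = {w₁,…,w_k}`, `R = {(w_i w̄_i, ε) : i ∈ [1,k]}`. Then
for every `x ∈ (W ∪ W̄)*` with `x ≡_Γ ε`: `x ↔*_R ε`, and every occurrence of a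
factor `w_i w̄_j` in `x` (every factorization `x = s · w_i w̄_j · t` with
`s, t ∈ (W ∪ W̄)*`) satisfies `i = j`. -/
theorem pushdown_cancellation {V : Type} (Γ : GGraph V) (u v : V) (huv : u ≠ v)
    (hnadj : ¬ Γ.adj u v) (hunl : ¬ Γ.adj u u) (k : ℕ) :
    ∀ x : GWord V, InStar u v k x → GEquiv Γ x [] →
      Relation.EqvGen (RStep (cancelRules u v k)) x [] ∧
      (∀ (i j : ℕ) (s t : GWord V), 1 ≤ i → i ≤ k → 1 ≤ j → j ≤ k →
        InStar u v k s → InStar u v k t →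
        x = s ++ (pword u v i ++ barW (pword u v j)) ++ t → i = j) := by
  intro x hx hxe
  have hrun : stackRun u v x [] = some [] := stackRun_eq_of_GEquiv huv hnadj hunl hxe []
  refine ⟨?_, ?_⟩
  · obtain ⟨parts, hparts, rfl⟩ := hx
    exact eqvGen_cancelRules_of_stackRun huv hparts (l := []) hrun
  · rintro i j s t - - - - - - rfl
    simp only [stackRun_append, Option.bind_eq_some_iff] at hrun
    obtain ⟨_, ⟨s₁, -, s₂, hs₂, hs₃⟩, -⟩ := hrun
    rw [stackRun_pword huv, Option.some_inj] at hs₂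
    rw [stackRun_barW_pword_eq_some huv, ← hs₂, List.cons.injEq, Nat.cast_inj] at hs₃
    exact hs₃.1
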